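/- The series ∑_{n=0}^∞ ((1/2)_n (1/3)_n (2/3)_n)/((1)_n^3) · (15n+2) · (2/27)^n equals 27/(4π). -/

import Mathlib

open Real

noncomputable def poch (a : ℝ) (n : ℕ) : ℝ := (ascPochhammer ℝ n).eval a

open Filter Topology

namespace RamaProof

/-- power series with coefficients `c` -/
noncomputable def ps (c : ℕ → ℝ) (z : ℝ) : ℝ := ∑' n : ℕ, c n * z ^ n

def PB (c : ℕ → ℝ) : Prop := ∃ k : ℕ, ∀ n : ℕ, |c n| ≤ ((n : ℝ) + 1) ^ k

lemma PB.mul_n {c : ℕ → ℝ} (h : PB c) : PB (fun n => (n : ℝ) * c n) := by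
  obtain ⟨k, hk⟩ := h
  refine ⟨k + 1, fun n => ?_⟩
  have hn : (0 : ℝ) ≤ n := Nat.cast_nonneg n
  rw [abs_mul, abs_of_nonneg hn, pow_succ, mul_comm]
  exact mul_le_mul (hk n) (by linarith) hn (by positivity)

lemma summable_aux (k : ℕ) {r : ℝ} (hr0 : 0 ≤ r) (hr : r < 1) :
    Summable (fun n : ℕ => ((n : ℝ) + 1) ^ k * r ^ n) := by
  have h0 : Summable (fun n : ℕ => ((n : ℝ)) ^ k * r ^ n) :=
    summable_pow_mul_geometric_of_norm_lt_one k (by rwa [Real.norm_eq_abs, abs_of_nonneg hr0])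
  have h1 : Summable (fun n : ℕ => r ^ n) := summable_geometric_of_lt_one hr0 hr
  refine Summable.of_nonneg_of_le (fun n => by positivity) (fun n => ?_)
    ((h0.mul_left (2 ^ k)).add h1)
  rcases Nat.eq_zero_or_pos n with rfl | hn
  · simp only [Nat.cast_zero, zero_add, one_pow, pow_zero, mul_one]
    have : (0 : ℝ) ≤ 2 ^ k * 0 ^ k := by positivity
    linarith
  · have h1n : (1 : ℝ) ≤ n := by exact_mod_cast hn
    have h2 : ((n : ℝ) + 1) ^ k ≤ (2 * n) ^ k := by gcongr; linarith
    rw [mul_pow] at h2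
    have h3 : (0 : ℝ) ≤ r ^ n := by positivity
    nlinarith [mul_le_mul_of_nonneg_right h2 h3]

lemma PB.summable {c : ℕ → ℝ} (h : PB c) {z : ℝ} (hz : |z| < 1) :
    Summable (fun n => c n * z ^ n) := by
  obtain ⟨k, hk⟩ := h
  refine Summable.of_norm_bounded (summable_aux k (abs_nonneg z) hz) (fun n => ?_)
  rw [Real.norm_eq_abs, abs_mul, abs_pow]
  exact mul_le_mul_of_nonneg_right (hk n) (by positivity)

lemma PB.hasDerivAt_aux {c : ℕ → ℝ} (h : PB c) {z : ℝ} (hz : |z| < 1) :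
    HasDerivAt (ps c) (∑' n : ℕ, c n * ((n : ℝ) * z ^ (n - 1))) z := by
  obtain ⟨k, hk⟩ := h.mul_n
  obtain ⟨r, hr1, hr2⟩ := exists_between hz
  have hr0 : 0 < r := lt_of_le_of_lt (abs_nonneg z) hr1
  refine hasDerivAt_tsum_of_isPreconnected
    (u := fun n : ℕ => r⁻¹ * (((n : ℝ) + 1) ^ k * r ^ n)) (t := Set.Ioo (-r) r)
    (g := fun (n : ℕ) y => c n * y ^ n) (g' := fun (n : ℕ) y => c n * ((n : ℝ) * y ^ (n - 1)))
    ((summable_aux k hr0.le hr2).mul_left _) isOpen_Ioo isPreconnected_Ioo ?_ ?_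
    (y₀ := 0) ⟨by linarith, hr0⟩ (h.summable (by simp)) (abs_lt.mp hr1)
  · intro n y _
    exact (hasDerivAt_pow n y).const_mul (c n)
  · intro n y hy
    have hy' : |y| ≤ r := (abs_lt.mpr hy).le
    rw [Real.norm_eq_abs]
    rcases Nat.eq_zero_or_pos n with rfl | hn
    · simp; positivity
    · have e : r⁻¹ * (((n : ℝ) + 1) ^ k * r ^ n) = ((n : ℝ) + 1) ^ k * r ^ (n - 1) := by
        obtain ⟨m, rfl⟩ : ∃ m, n = m + 1 := ⟨n - 1, by omega⟩
        simp only [Nat.add_sub_cancel, pow_succ r]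
        field_simp
      rw [e, show c n * ((n : ℝ) * y ^ (n - 1)) = ((n : ℝ) * c n) * y ^ (n - 1) by ring,
        abs_mul, abs_pow]
      exact mul_le_mul (hk n) (pow_le_pow_left₀ (abs_nonneg _) hy' _) (by positivity)
        (by positivity)

lemma PB.continuousAt {c : ℕ → ℝ} (h : PB c) {z : ℝ} (hz : |z| < 1) :
    ContinuousAt (ps c) z := (h.hasDerivAt_aux hz).continuousAt

lemma PB.hasDerivAt {c : ℕ → ℝ} (h : PB c) {z : ℝ} (hz : |z| < 1) (h0 : z ≠ 0) :
    HasDerivAt (ps c) (ps (fun n => (n : ℝ) * c n) z / z) z := by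
  convert h.hasDerivAt_aux hz using 1
  rw [div_eq_iff h0, ps, ← tsum_mul_right]
  congr 1
  ext n
  rcases Nat.eq_zero_or_pos n with rfl | hn
  · simp
  · obtain ⟨m, rfl⟩ : ∃ m, n = m + 1 := ⟨n - 1, by omega⟩
    simp only [Nat.add_sub_cancel, pow_succ]
    ring

lemma ps_zero (c : ℕ → ℝ) : ps c 0 = c 0 := by
  rw [ps, tsum_eq_single 0]
  · simp
  · intro n hn; simp [hn]

lemma const_lem {f : ℝ → ℝ} {a b : ℝ} (hab : a < b) (hc : ContinuousOn f (Set.Icc a b))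
    (hd : ∀ x ∈ Set.Ioo a b, HasDerivAt f 0 x) : f b = f a := by
  obtain ⟨c, _, h⟩ := exists_hasDerivAt_eq_slope f (fun _ => 0) hab hc hd
  have : b - a ≠ 0 := by linarith
  field_simp at h
  linarith

lemma poch_succ (a : ℝ) (n : ℕ) : poch a (n + 1) = poch a n * (a + n) := by
  rw [poch, poch, ascPochhammer_succ_eval]

lemma poch_zero (a : ℝ) : poch a 0 = 1 := by simp [poch]

lemma poch_pos {a : ℝ} (ha : 0 < a) (n : ℕ) : 0 < poch a n := by
  induction n with
  | zero => rw [poch_zero]; norm_num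
  | succ n ih => rw [poch_succ]; positivity

lemma poch_le {a : ℝ} (ha : 0 < a) (ha1 : a ≤ 1) (n : ℕ) : poch a n ≤ poch 1 n := by
  induction n with
  | zero => simp [poch_zero]
  | succ n ih =>
    rw [poch_succ, poch_succ]
    exact mul_le_mul ih (by linarith) (by positivity) (poch_pos one_pos n).le

noncomputable def v (a : ℝ) (n : ℕ) : ℝ := poch a n / poch 1 n

lemma v_zero (a : ℝ) : v a 0 = 1 := by simp [v, poch_zero]
lemma v_pos {a : ℝ} (ha : 0 < a) (n : ℕ) : 0 < v a n := div_pos (poch_pos ha n) (poch_pos one_pos n)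
lemma v_le {a : ℝ} (ha : 0 < a) (ha1 : a ≤ 1) (n : ℕ) : v a n ≤ 1 :=
  (div_le_one (poch_pos one_pos n)).mpr (poch_le ha ha1 n)
lemma v_succ (a : ℝ) (n : ℕ) : ((n : ℝ) + 1) * v a (n + 1) = (a + n) * v a n := by
  have := (poch_pos one_pos n).ne'
  have h2 : (1 : ℝ) + n ≠ 0 := by positivity
  rw [v, v, poch_succ, poch_succ]
  field_simp
  ring

noncomputable def u (n : ℕ) : ℝ := v (1/2) n * v (1/3) n * v (2/3) n

lemma u_zero : u 0 = 1 := by simp [u, v_zero]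
lemma u_nonneg (n : ℕ) : 0 ≤ u n := by
  have h1 := v_pos (a := 1/2) (by norm_num) n
  have h2 := v_pos (a := 1/3) (by norm_num) n
  have h3 := v_pos (a := 2/3) (by norm_num) n
  rw [u]; positivity
lemma u_le (n : ℕ) : u n ≤ 1 := by
  have h1 := v_pos (a := 1/2) (by norm_num) n
  have h2 := v_pos (a := 1/3) (by norm_num) n
  have h3 := v_pos (a := 2/3) (by norm_num) n
  have h1' := v_le (a := 1/2) (by norm_num) (by norm_num) n
  have h2' := v_le (a := 1/3) (by norm_num) (by norm_num) n
  have h3' := v_le (a := 2/3) (by norm_num) (by norm_num) n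
  rw [u]
  exact mul_le_one₀ (mul_le_one₀ h1' h2.le h2') h3.le h3'
lemma u_succ (n : ℕ) :
    ((n : ℝ) + 1) ^ 3 * u (n + 1) = (1/2 + n) * (1/3 + n) * (2/3 + n) * u n := by
  have h1 := v_succ (1/2) n
  have h2 := v_succ (1/3) n
  have h3 := v_succ (2/3) n
  rw [u, u]
  calc _ = (((n : ℝ) + 1) * v (1/2) (n + 1)) * (((n : ℝ) + 1) * v (1/3) (n + 1)) *
        (((n : ℝ) + 1) * v (2/3) (n + 1)) := by ring
    _ = _ := by rw [h1, h2, h3]; ring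

noncomputable def uc : ℕ → ℕ → ℝ
  | 0 => u
  | i + 1 => fun n => (n : ℝ) * uc i n

lemma PB_uc (i : ℕ) : PB (uc i) := by
  induction i with
  | zero =>
    refine ⟨0, fun n => ?_⟩
    rw [uc, pow_zero, abs_of_nonneg (u_nonneg n)]; exact u_le n
  | succ i ih => exact ih.mul_n

noncomputable def A (i : ℕ) (z : ℝ) : ℝ := ps (uc i) z

lemma A_cont (i : ℕ) {z : ℝ} (hz : |z| < 1) : ContinuousAt (A i) z := (PB_uc i).continuousAt hz
lemma A_deriv (i : ℕ) {z : ℝ} (hz : |z| < 1) (h0 : z ≠ 0) :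
    HasDerivAt (A i) (A (i + 1) z / z) z := (PB_uc i).hasDerivAt hz h0

lemma A0_zero : A 0 0 = 1 := by rw [A, ps_zero]; exact u_zero
lemma A1_zero : A 1 0 = 0 := by rw [A, ps_zero]; simp [uc]
lemma A2_zero : A 2 0 = 0 := by rw [A, ps_zero]; simp [uc]

lemma A0_pos {z : ℝ} (h0 : 0 ≤ z) (h1 : z < 1) : 0 < A 0 z := by
  have hs := (PB_uc 0).summable (z := z) (by rwa [abs_of_nonneg h0])
  have h := hs.sum_le_tsum (Finset.range 1)
    (fun n _ => mul_nonneg (u_nonneg n) (pow_nonneg h0 n))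
  simp [u_zero] at h
  rw [A, ps]
  simp only [uc]
  linarith

lemma A_ode {z : ℝ} (hz : |z| < 1) :
    A 3 z = z * (A 3 z + 3/2 * A 2 z + 13/18 * A 1 z + 1/9 * A 0 z) := by
  have s0 := (PB_uc 0).summable hz
  have s1 := (PB_uc 1).summable hz
  have s2 := (PB_uc 2).summable hz
  have s3 := (PB_uc 3).summable hz
  have hs : HasSum (fun n => z * (uc 3 n * z ^ n + 3/2 * (uc 2 n * z ^ n)
      + 13/18 * (uc 1 n * z ^ n) + 1/9 * (uc 0 n * z ^ n)))
      (z * (A 3 z + 3/2 * A 2 z + 13/18 * A 1 z + 1/9 * A 0 z)) :=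
    (((s3.hasSum.add (s2.hasSum.mul_left _)).add (s1.hasSum.mul_left _)).add
      (s0.hasSum.mul_left _)).mul_left _
  rw [← hs.tsum_eq, A, ps, s3.tsum_eq_zero_add]
  simp only [uc, Nat.cast_zero, zero_mul, zero_add]
  congr 1
  ext n
  have := u_succ n
  push_cast
  calc _ = ((n : ℝ) + 1) ^ 3 * u (n + 1) * z ^ (n + 1) := by ring
    _ = _ := by rw [this]; ring

lemma J_zero {z : ℝ} (h0 : 0 ≤ z) (h1 : z < 1) :
    (1 - z) * (2 * A 0 z * A 2 z - A 1 z ^ 2) - z * A 0 z * A 1 z - 2/9 * z * A 0 z ^ 2 = 0 := by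
  rcases h0.eq_or_lt with rfl | hpos
  · rw [A0_zero, A1_zero, A2_zero]; norm_num
  have key := const_lem (f := fun z => (1 - z) * (2 * A 0 z * A 2 z - A 1 z ^ 2)
      - z * A 0 z * A 1 z - 2/9 * z * A 0 z ^ 2) hpos ?_ ?_
  · rw [key, A0_zero, A1_zero, A2_zero]; norm_num
  · intro x hx
    have hx' : |x| < 1 := by rw [abs_of_nonneg hx.1]; linarith [hx.2]
    have c0 := A_cont 0 hx'
    have c1 := A_cont 1 hx'
    have c2 := A_cont 2 hx'
    apply ContinuousAt.continuousWithinAt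
    fun_prop
  · intro x hx
    have hx' : |x| < 1 := by rw [abs_of_nonneg hx.1.le]; linarith [hx.2]
    have hx0 : x ≠ 0 := hx.1.ne'
    have d0 := A_deriv 0 hx' hx0
    have d1 := A_deriv 1 hx' hx0
    have d2 := A_deriv 2 hx' hx0
    have ode := A_ode hx'
    have di := hasDerivAt_id x
    have := (((di.const_sub 1).mul (((d0.const_mul 2).mul d2).sub (d1.pow 2))).sub
      ((di.mul d0).mul d1)).sub ((di.const_mul (2/9)).mul (d0.pow 2))
    refine this.congr_deriv ?_
    simp only [id, Pi.mul_apply, Pi.sub_apply, Pi.pow_apply]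
    norm_num
    field_simp
    linear_combination (18 * A 0 x) * ode

noncomputable def z1 (s : ℝ) : ℝ := s * (3 - s) ^ 2 / (1 + s) ^ 3
noncomputable def z2 (s : ℝ) : ℝ := s ^ 2 * (3 - s) / 4

lemma one_sub_z1 {s : ℝ} (h0 : 0 ≤ s) : 1 - z1 s = (1 - 3 * s) ^ 2 / (1 + s) ^ 3 := by
  have : 1 + s ≠ 0 := by positivity
  rw [z1]; field_simp; ring

lemma z1_nonneg {s : ℝ} (h0 : 0 ≤ s) : 0 ≤ z1 s := by rw [z1]; positivity
lemma z1_lt {s : ℝ} (h0 : 0 ≤ s) (h1 : s < 1/3) : z1 s < 1 := by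
  have h := one_sub_z1 h0
  have : 0 < (1 - 3 * s) ^ 2 / (1 + s) ^ 3 := by
    have : 0 < 1 - 3 * s := by linarith
    positivity
  linarith
lemma z1_abs {s : ℝ} (h0 : 0 ≤ s) (h1 : s < 1/3) : |z1 s| < 1 := by
  rw [abs_of_nonneg (z1_nonneg h0)]; exact z1_lt h0 h1
lemma z2_nonneg {s : ℝ} (h0 : 0 ≤ s) (h1 : s ≤ 1/3) : 0 ≤ z2 s := by
  have : 0 ≤ 3 - s := by linarith
  rw [z2]; positivity
lemma z2_lt {s : ℝ} (h0 : 0 ≤ s) (h1 : s ≤ 1/3) : z2 s < 1 := by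
  rw [z2]
  have h2 : s ^ 2 ≤ 1 := by nlinarith
  have : s ^ 2 * (3 - s) ≤ 1 * 3 := mul_le_mul h2 (by linarith) (by linarith) (by norm_num)
  linarith
lemma z2_abs {s : ℝ} (h0 : 0 ≤ s) (h1 : s ≤ 1/3) : |z2 s| < 1 := by
  rw [abs_of_nonneg (z2_nonneg h0 h1)]; exact z2_lt h0 h1

lemma z1_deriv {s : ℝ} (h0 : 0 ≤ s) :
    HasDerivAt z1 (3 * (1 - 3 * s) * (3 - s) / (1 + s) ^ 4) s := by
  have h : 1 + s ≠ 0 := by positivity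
  have di := hasDerivAt_id s
  have := (di.mul ((di.const_sub 3).pow 2)).div ((di.const_add 1).pow 3) (pow_ne_zero 3 h)
  refine this.congr_deriv ?_
  simp only [id, Pi.mul_apply, Pi.sub_apply, Pi.pow_apply]
  norm_num
  field_simp
  ring

lemma z2_deriv (s : ℝ) : HasDerivAt z2 ((6 * s - 3 * s ^ 2) / 4) s := by
  have di := hasDerivAt_id s
  have := ((di.pow 2).mul (di.const_sub 3)).div_const 4
  refine this.congr_deriv ?_
  simp only [id, Pi.mul_apply, Pi.sub_apply, Pi.pow_apply]
  norm_num
  ring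

lemma dAz1 (i : ℕ) {s : ℝ} (h0 : 0 < s) (h1 : s < 1/3) :
    HasDerivAt (fun s => A i (z1 s))
      (3 * (1 - 3 * s) / ((1 + s) * (3 - s) * s) * A (i + 1) (z1 s)) s := by
  have h3 : 3 - s ≠ 0 := by linarith
  have hp : 1 + s ≠ 0 := by positivity
  have hz : z1 s ≠ 0 := by rw [z1]; positivity
  have := (A_deriv i (z1_abs h0.le h1) hz).comp s (z1_deriv h0.le)
  refine this.congr_deriv ?_
  have e : 3 * (1 - 3 * s) * (3 - s) / (1 + s) ^ 4 =
      z1 s * (3 * (1 - 3 * s) / ((1 + s) * (3 - s) * s)) := by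
    rw [z1]; field_simp
  rw [e]; field_simp

lemma dAz2 (i : ℕ) {s : ℝ} (h0 : 0 < s) (h1 : s < 1/3) :
    HasDerivAt (fun s => A i (z2 s))
      ((6 - 3 * s) / ((3 - s) * s) * A (i + 1) (z2 s)) s := by
  have h3 : 3 - s ≠ 0 := by linarith
  have hz : z2 s ≠ 0 := by rw [z2]; positivity
  have := (A_deriv i (z2_abs h0.le h1.le) hz).comp s (z2_deriv s)
  refine this.congr_deriv ?_
  have e : (6 * s - 3 * s ^ 2) / 4 = z2 s * ((6 - 3 * s) / ((3 - s) * s)) := by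
    rw [z2]; field_simp
  rw [e]; field_simp

lemma cAz1 (i : ℕ) {s : ℝ} (h0 : 0 ≤ s) (h1 : s < 1/3) :
    ContinuousAt (fun s => A i (z1 s)) s :=
  ContinuousAt.comp (f := z1) (A_cont i (z1_abs h0 h1)) (z1_deriv h0).continuousAt

lemma cAz2 (i : ℕ) {s : ℝ} (h0 : 0 ≤ s) (h1 : s ≤ 1/3) :
    ContinuousAt (fun s => A i (z2 s)) s :=
  ContinuousAt.comp (f := z2) (A_cont i (z2_abs h0 h1)) (z2_deriv s).continuousAt

noncomputable def X (s : ℝ) : ℝ :=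
  3 * (1 - 3 * s) / (1 + s) * A 1 (z1 s) * A 0 (z2 s)
    - s * (3 - s) / (1 + s) * A 0 (z1 s) * A 0 (z2 s)
    - (6 - 3 * s) * A 0 (z1 s) * A 1 (z2 s)

lemma X_cont {s : ℝ} (h0 : 0 ≤ s) (h1 : s < 1/3) : ContinuousAt X s := by
  have c1 := cAz1 0 h0 h1
  have c2 := cAz1 1 h0 h1
  have c3 := cAz2 0 h0 h1.le
  have c4 := cAz2 1 h0 h1.le
  have hp : 1 + s ≠ 0 := by positivity
  unfold X
  fun_prop (disch := assumption)

lemma alg (s a0 a1 a2 b0 b1 b2 : ℝ) (hs : s ≠ 0) (hp : 1 + s ≠ 0) (h3 : 3 - s ≠ 0)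
    (j1 : (1 - 3 * s) ^ 2 * (2 * a0 * a2 - a1 ^ 2) = s * (3 - s) ^ 2 * (a0 * a1 + 2/9 * a0 ^ 2))
    (j2 : (2 - s) ^ 2 * (1 + s) * (2 * b0 * b2 - b1 ^ 2)
      = s ^ 2 * (3 - s) * (b0 * b1 + 2/9 * b0 ^ 2)) :
    2 * (-12 / (1 + s) ^ 2 * a1 * b0
      + 3 * (1 - 3 * s) / (1 + s) * (3 * (1 - 3 * s) / ((1 + s) * (3 - s) * s) * a2) * b0
      + 3 * (1 - 3 * s) / (1 + s) * a1 * ((6 - 3 * s) / ((3 - s) * s) * b1)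
      - (3 - 2 * s - s ^ 2) / (1 + s) ^ 2 * a0 * b0
      - s * (3 - s) / (1 + s) * (3 * (1 - 3 * s) / ((1 + s) * (3 - s) * s) * a1) * b0
      - s * (3 - s) / (1 + s) * a0 * ((6 - 3 * s) / ((3 - s) * s) * b1)
      + 3 * a0 * b1
      - (6 - 3 * s) * (3 * (1 - 3 * s) / ((1 + s) * (3 - s) * s) * a1) * b1
      - (6 - 3 * s) * a0 * ((6 - 3 * s) / ((3 - s) * s) * b2)) * (a0 * b0)
    - (3 * (1 - 3 * s) / (1 + s) * a1 * b0 - s * (3 - s) / (1 + s) * a0 * b0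
        - (6 - 3 * s) * a0 * b1)
      * ((3 * (1 - 3 * s) / ((1 + s) * (3 - s) * s) * a1) * b0
        + a0 * ((6 - 3 * s) / ((3 - s) * s) * b1)) = 0 := by
  have e : 2 * (-12 / (1 + s) ^ 2 * a1 * b0
      + 3 * (1 - 3 * s) / (1 + s) * (3 * (1 - 3 * s) / ((1 + s) * (3 - s) * s) * a2) * b0
      + 3 * (1 - 3 * s) / (1 + s) * a1 * ((6 - 3 * s) / ((3 - s) * s) * b1)
      - (3 - 2 * s - s ^ 2) / (1 + s) ^ 2 * a0 * b0
      - s * (3 - s) / (1 + s) * (3 * (1 - 3 * s) / ((1 + s) * (3 - s) * s) * a1) * b0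
      - s * (3 - s) / (1 + s) * a0 * ((6 - 3 * s) / ((3 - s) * s) * b1)
      + 3 * a0 * b1
      - (6 - 3 * s) * (3 * (1 - 3 * s) / ((1 + s) * (3 - s) * s) * a1) * b1
      - (6 - 3 * s) * a0 * ((6 - 3 * s) / ((3 - s) * s) * b2)) * (a0 * b0)
    - (3 * (1 - 3 * s) / (1 + s) * a1 * b0 - s * (3 - s) / (1 + s) * a0 * b0
        - (6 - 3 * s) * a0 * b1)
      * ((3 * (1 - 3 * s) / ((1 + s) * (3 - s) * s) * a1) * b0
        + a0 * ((6 - 3 * s) / ((3 - s) * s) * b1))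
    = 9 * b0 ^ 2 / ((3 - s) * s * (1 + s) ^ 2) * ((1 - 3 * s) ^ 2 * (2 * a0 * a2 - a1 ^ 2)
        - s * (3 - s) ^ 2 * (a0 * a1 + 2/9 * a0 ^ 2))
      - 9 * a0 ^ 2 / ((3 - s) * s * (1 + s)) * ((2 - s) ^ 2 * (1 + s) * (2 * b0 * b2 - b1 ^ 2)
        - s ^ 2 * (3 - s) * (b0 * b1 + 2/9 * b0 ^ 2)) := by
    field_simp
    ring
  rw [e, j1, j2]
  ring

lemma J1 {s : ℝ} (h0 : 0 ≤ s) (h1 : s < 1/3) :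
    (1 - 3 * s) ^ 2 * (2 * A 0 (z1 s) * A 2 (z1 s) - A 1 (z1 s) ^ 2)
      = s * (3 - s) ^ 2 * (A 0 (z1 s) * A 1 (z1 s) + 2/9 * A 0 (z1 s) ^ 2) := by
  have h := J_zero (z1_nonneg h0) (z1_lt h0 h1)
  have hp : 1 + s ≠ 0 := by positivity
  have e1 : (1 - 3 * s) ^ 2 = (1 + s) ^ 3 * (1 - z1 s) := by rw [one_sub_z1 h0]; field_simp
  have e2 : s * (3 - s) ^ 2 = (1 + s) ^ 3 * z1 s := by rw [z1]; field_simp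
  rw [e1, e2]
  linear_combination (1 + s) ^ 3 * h

lemma J2 {s : ℝ} (h0 : 0 ≤ s) (h1 : s < 1/3) :
    (2 - s) ^ 2 * (1 + s) * (2 * A 0 (z2 s) * A 2 (z2 s) - A 1 (z2 s) ^ 2)
      = s ^ 2 * (3 - s) * (A 0 (z2 s) * A 1 (z2 s) + 2/9 * A 0 (z2 s) ^ 2) := by
  have h := J_zero (z2_nonneg h0 h1.le) (z2_lt h0 h1.le)
  have e1 : (2 - s) ^ 2 * (1 + s) = 4 * (1 - z2 s) := by rw [z2]; ring
  have e2 : s ^ 2 * (3 - s) = 4 * z2 s := by rw [z2]; ring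
  rw [e1, e2]
  linear_combination 4 * h

lemma X_zero {s : ℝ} (h0 : 0 ≤ s) (h1 : s < 1/3) : X s = 0 := by
  have z10 : z1 0 = 0 := by simp [z1]
  have z20 : z2 0 = 0 := by simp [z2]
  have X0 : X 0 = 0 := by simp [X, z10, z20, A1_zero]
  rcases h0.eq_or_lt with rfl | hpos
  · exact X0
  have key := const_lem (f := fun s => X s ^ 2 / (A 0 (z1 s) * A 0 (z2 s))) hpos ?_ ?_
  · simp only [X0] at key
    have p1 := A0_pos (z1_nonneg h0) (z1_lt h0 h1)
    have p2 := A0_pos (z2_nonneg h0 h1.le) (z2_lt h0 h1.le)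
    have p := mul_pos p1 p2
    rw [zero_pow two_ne_zero, zero_div, div_eq_zero_iff] at key
    rcases key with key | key
    · exact pow_eq_zero_iff two_ne_zero |>.mp key
    · exact absurd key p.ne'
  · intro x hx
    have hx0 : 0 ≤ x := hx.1
    have hx1 : x < 1/3 := lt_of_le_of_lt hx.2 h1
    have p1 := A0_pos (z1_nonneg hx0) (z1_lt hx0 hx1)
    have p2 := A0_pos (z2_nonneg hx0 hx1.le) (z2_lt hx0 hx1.le)
    exact (((X_cont hx0 hx1).pow 2).div ((cAz1 0 hx0 hx1).mul (cAz2 0 hx0 hx1.le))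
      (mul_pos p1 p2).ne').continuousWithinAt
  · intro x hx
    have hx0 : 0 < x := hx.1
    have hx1 : x < 1/3 := lt_trans hx.2 h1
    have p1 := A0_pos (z1_nonneg hx0.le) (z1_lt hx0.le hx1)
    have p2 := A0_pos (z2_nonneg hx0.le hx1.le) (z2_lt hx0.le hx1.le)
    have hp : 1 + x ≠ 0 := by positivity
    have h3 : 3 - x ≠ 0 := by linarith
    have di := hasDerivAt_id x
    have a0 := dAz1 0 hx0 hx1
    have a1 := dAz1 1 hx0 hx1
    have b0 := dAz2 0 hx0 hx1
    have b1 := dAz2 1 hx0 hx1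
    have dα : HasDerivAt (fun s : ℝ => 3 * (1 - 3 * s) / (1 + s)) (-12 / (1 + x) ^ 2) x := by
      refine ((((di.const_mul 3).const_sub 1).const_mul 3).div (di.const_add 1) hp).congr_deriv ?_
      simp only [id]; field_simp; ring
    have dβ : HasDerivAt (fun s : ℝ => s * (3 - s) / (1 + s))
        ((3 - 2 * x - x ^ 2) / (1 + x) ^ 2) x := by
      refine ((di.mul (di.const_sub 3)).div (di.const_add 1) hp).congr_deriv ?_
      simp only [id, Pi.mul_apply]; field_simp; ring
    have dγ : HasDerivAt (fun s : ℝ => 6 - 3 * s) (-3) x := by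
      refine ((di.const_mul 3).const_sub 6).congr_deriv ?_
      ring
    have dX := (((dα.mul a1).mul b0).sub ((dβ.mul a0).mul b0)).sub ((dγ.mul a0).mul b1)
    have al := alg x _ _ _ _ _ _ hx0.ne' hp h3 (J1 hx0.le hx1) (J2 hx0.le hx1)
    refine ((dX.pow 2).div (a0.mul b0) (mul_pos p1 p2).ne').congr_deriv ?_
    rw [div_eq_zero_iff]
    left
    simp only [Pi.mul_apply, Pi.sub_apply, Pi.pow_apply]
    norm_num at al ⊢
    linear_combination (3 * (1 - 3 * x) / (1 + x) * A 1 (z1 x) * A 0 (z2 x)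
      - x * (3 - x) / (1 + x) * A 0 (z1 x) * A 0 (z2 x)
      - (6 - 3 * x) * A 0 (z1 x) * A 1 (z2 x)) * al

lemma trans_eq {s : ℝ} (h0 : 0 ≤ s) (h1 : s < 1/3) : A 0 (z1 s) = (1 + s) * A 0 (z2 s) := by
  have z10 : z1 0 = 0 := by simp [z1]
  have z20 : z2 0 = 0 := by simp [z2]
  rcases h0.eq_or_lt with rfl | hpos
  · simp [z10, z20]
  have key := const_lem (f := fun s => A 0 (z1 s) / ((1 + s) * A 0 (z2 s))) hpos ?_ ?_
  · have p2 := A0_pos (z2_nonneg h0 h1.le) (z2_lt h0 h1.le)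
    have : (1 + s) * A 0 (z2 s) ≠ 0 := by positivity
    simp only [z10, z20, A0_zero] at key
    rw [div_eq_iff this] at key
    rw [key]; ring
  · intro x hx
    have hx0 : 0 ≤ x := hx.1
    have hx1 : x < 1/3 := lt_of_le_of_lt hx.2 h1
    have p2 := A0_pos (z2_nonneg hx0 hx1.le) (z2_lt hx0 hx1.le)
    have : (1 + x) * A 0 (z2 x) ≠ 0 := by positivity
    have ci : ContinuousAt (fun s : ℝ => 1 + s) x := by fun_prop
    exact ((cAz1 0 hx0 hx1).div (ci.mul (cAz2 0 hx0 hx1.le)) this).continuousWithinAt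
  · intro x hx
    have hx0 : 0 < x := hx.1
    have hx1 : x < 1/3 := lt_trans hx.2 h1
    have p2 := A0_pos (z2_nonneg hx0.le hx1.le) (z2_lt hx0.le hx1.le)
    have hp : 1 + x ≠ 0 := by positivity
    have h3 : 3 - x ≠ 0 := by linarith
    have : (1 + x) * A 0 (z2 x) ≠ 0 := by positivity
    have di := hasDerivAt_id x
    have hX := X_zero hx0.le hx1
    refine ((dAz1 0 hx0 hx1).div ((di.const_add 1).mul (dAz2 0 hx0 hx1)) this).congr_deriv ?_
    rw [div_eq_zero_iff]
    left
    have e : 3 * (1 - 3 * x) / ((1 + x) * (3 - x) * x) * A 1 (z1 x) * ((1 + x) * A 0 (z2 x)) -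
        A 0 (z1 x) * (1 * A 0 (z2 x) + (1 + x) * ((6 - 3 * x) / ((3 - x) * x) * A 1 (z2 x)))
        = (1 + x) / ((3 - x) * x) * X x := by
      rw [X]; field_simp; ring
    rw [hX, mul_zero] at e
    exact e

lemma main_rel {s : ℝ} (h0 : 0 ≤ s) (h1 : s < 1/3) :
    3 * (1 - 3 * s) / (1 + s) * A 1 (z1 s)
      = s * (3 - s) * A 0 (z2 s) + (1 + s) * (6 - 3 * s) * A 1 (z2 s) := by
  have hX := X_zero h0 h1
  have p2 := A0_pos (z2_nonneg h0 h1.le) (z2_lt h0 h1.le)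
  have hp : 1 + s ≠ 0 := by positivity
  rw [X, trans_eq h0 h1] at hX
  apply mul_right_cancel₀ p2.ne'
  have e : s * (3 - s) / (1 + s) * ((1 + s) * A 0 (z2 s)) = s * (3 - s) * A 0 (z2 s) := by
    field_simp
  rw [e] at hX
  linear_combination hX

lemma PB_v : PB (v (1/2)) := by
  refine ⟨0, fun n => ?_⟩
  rw [pow_zero, abs_of_nonneg (v_pos (by norm_num) n).le]
  exact v_le (by norm_num) (by norm_num) n

lemma B_ode {z : ℝ} (hz : |z| < 1) :
    ps (fun n => (n : ℝ) * v (1/2) n) z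
      = z * (ps (fun n => (n : ℝ) * v (1/2) n) z + 1/2 * ps (v (1/2)) z) := by
  have s0 := PB_v.summable hz
  have s1 := PB_v.mul_n.summable hz
  have hs : HasSum (fun n : ℕ => z * ((n : ℝ) * v (1/2) n * z ^ n + 1/2 * (v (1/2) n * z ^ n)))
      (z * (ps (fun n => (n : ℝ) * v (1/2) n) z + 1/2 * ps (v (1/2)) z)) :=
    (s1.hasSum.add (s0.hasSum.mul_left _)).mul_left _
  rw [← hs.tsum_eq, ps, s1.tsum_eq_zero_add]
  simp only [Nat.cast_zero, zero_mul, zero_add]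
  congr 1
  ext n
  have := v_succ (1/2) n
  push_cast
  rw [this]; ring

lemma B_sq {z : ℝ} (h0 : 0 ≤ z) (h1 : z < 1) : ps (v (1/2)) z ^ 2 * (1 - z) = 1 := by
  rcases h0.eq_or_lt with rfl | hpos
  · rw [ps_zero, v_zero]; norm_num
  have key := const_lem (f := fun z => ps (v (1/2)) z ^ 2 * (1 - z)) hpos ?_ ?_
  · rw [key, ps_zero, v_zero]; norm_num
  · intro x hx
    have hx' : |x| < 1 := by rw [abs_of_nonneg hx.1]; linarith [hx.2]
    have c0 := PB_v.continuousAt hx'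
    apply ContinuousAt.continuousWithinAt
    fun_prop
  · intro x hx
    have hx' : |x| < 1 := by rw [abs_of_nonneg hx.1.le]; linarith [hx.2]
    have hx0 : x ≠ 0 := hx.1.ne'
    have d0 := PB_v.hasDerivAt hx' hx0
    have ode := B_ode hx'
    have di := hasDerivAt_id x
    refine ((d0.pow 2).mul (di.const_sub 1)).congr_deriv ?_
    simp only [id, Pi.pow_apply]
    field_simp
    norm_num
    linear_combination (2 * ps (v (1/2)) x) * ode

lemma B_nonneg {z : ℝ} (h0 : 0 ≤ z) : 0 ≤ ps (v (1/2)) z :=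
  tsum_nonneg fun n => mul_nonneg (v_pos (by norm_num) n).le (pow_nonneg h0 n)

lemma B_sqrt {z : ℝ} (h0 : 0 ≤ z) (h1 : z < 1) : ps (v (1/2)) z * √(1 - z) = 1 := by
  have h := B_sq h0 h1
  have h2 : (ps (v (1/2)) z * √(1 - z)) ^ 2 = 1 := by
    rw [mul_pow, Real.sq_sqrt (by linarith), h]
  have h3 : 0 ≤ ps (v (1/2)) z * √(1 - z) := mul_nonneg (B_nonneg h0) (Real.sqrt_nonneg _)
  nlinarith

lemma poch_prod (a : ℝ) (n : ℕ) : poch a n = ∏ j ∈ Finset.range n, (a + j) := by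
  induction n with
  | zero => simp [poch_zero]
  | succ n ih => rw [poch_succ, Finset.prod_range_succ, ih]

lemma poch_one (n : ℕ) : poch 1 n = (n.factorial : ℝ) := by
  induction n with
  | zero => simp [poch_zero]
  | succ n ih => rw [poch_succ, ih, Nat.factorial_succ]; push_cast; ring

lemma gseq {a : ℝ} (ha : 0 < a) (n : ℕ) :
    Real.GammaSeq a n * (a + n) * v a n = (n : ℝ) ^ a := by
  have h1 := (poch_pos ha n).ne'
  have h2 : a + n ≠ 0 := by positivity
  have h3 : (n.factorial : ℝ) ≠ 0 := by exact_mod_cast n.factorial_ne_zero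
  rw [Real.GammaSeq, ← poch_prod, poch_succ, v, poch_one]
  field_simp

noncomputable def r (n : ℕ) : ℝ := n * (v (1/3) n * v (2/3) n)

lemma r_tendsto : Tendsto r atTop (𝓝 (√3 / (2 * π))) := by
  have g1 := Real.GammaSeq_tendsto_Gamma (1/3)
  have g2 := Real.GammaSeq_tendsto_Gamma (2/3)
  have gr := Real.Gamma_mul_Gamma_one_sub (1/3)
  have hs : Real.sin (π * (1/3)) = √3 / 2 := by
    rw [← Real.sin_pi_div_three]; congr 1; ring
  rw [hs, show (1 : ℝ) - 1/3 = 2/3 by norm_num] at gr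
  have hpi := Real.pi_pos
  have h3 : 0 < √(3 : ℝ) := Real.sqrt_pos.mpr (by norm_num)
  have t1 := tendsto_natCast_div_add_atTop (𝕜 := ℝ) (1/3)
  have t2 := tendsto_natCast_div_add_atTop (𝕜 := ℝ) (2/3)
  have hg := g1.mul g2
  rw [gr] at hg
  have := (t1.mul t2).div hg (by positivity)
  have e : (1 * 1 / (π / (√3 / 2)) : ℝ) = √3 / (2 * π) := by field_simp
  rw [e] at this
  refine this.congr' ?_
  filter_upwards [eventually_ge_atTop 1] with n hn
  have hn0 : (0 : ℝ) < n := by exact_mod_cast hn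
  have q1 := gseq (a := 1/3) (by norm_num) n
  have q2 := gseq (a := 2/3) (by norm_num) n
  have q : (n : ℝ) ^ (1/3 : ℝ) * (n : ℝ) ^ (2/3 : ℝ) = n := by
    rw [← Real.rpow_add hn0]; norm_num
  rw [← q1, ← q2] at q
  have k1 : Real.GammaSeq (1/3) n ≠ 0 := by
    intro h; rw [h] at q; simp at q; exact hn0.ne q
  have k2 : Real.GammaSeq (2/3) n ≠ 0 := by
    intro h; rw [h] at q; simp at q; exact hn0.ne q
  have k3 : (n : ℝ) + 1/3 ≠ 0 := by positivity
  have k4 : (n : ℝ) + 2/3 ≠ 0 := by positivity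
  simp only [Pi.div_apply]
  rw [div_mul_div_comm, div_div, div_eq_iff (by positivity), r]
  linear_combination (-(n : ℝ)) * q

lemma abel : Tendsto (fun z => A 1 z * √(1 - z)) (𝓝[<] 1) (𝓝 (√3 / (2 * π))) := by
  set L := √3 / (2 * π) with hL
  rw [Metric.tendsto_nhds]
  intro ε hε
  obtain ⟨N, hN⟩ := (Metric.tendsto_atTop.mp r_tendsto) (ε / 2) (by positivity)
  set C := ∑ n ∈ Finset.range N, |r n - L| with hC
  have hC0 : 0 ≤ C := Finset.sum_nonneg fun _ _ => abs_nonneg _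
  have hsq : Tendsto (fun z : ℝ => C * √(1 - z)) (𝓝[<] 1) (𝓝 0) := by
    have : ContinuousAt (fun z : ℝ => C * √(1 - z)) 1 := by fun_prop
    have h := this.tendsto
    simp only [sub_self, Real.sqrt_zero, mul_zero] at h
    exact h.mono_left nhdsWithin_le_nhds
  have hsmall := hsq.eventually (gt_mem_nhds (show (0 : ℝ) < ε / 2 by positivity))
  have hI : Set.Ioo (0 : ℝ) 1 ∈ 𝓝[<] (1 : ℝ) := Ioo_mem_nhdsLT (by norm_num)
  filter_upwards [hsmall, hI] with z hz hzI
  have hz0 : 0 ≤ z := hzI.1.le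
  have hz1 : |z| < 1 := by rw [abs_of_nonneg hz0]; exact hzI.2
  have sA := (PB_uc 1).summable hz1
  have sB := PB_v.summable hz1
  have bnd : |A 1 z - L * ps (v (1/2)) z| ≤ C + ε / 2 * ps (v (1/2)) z := by
    have hd : HasSum (fun n => uc 1 n * z ^ n - L * (v (1/2) n * z ^ n))
        (A 1 z - L * ps (v (1/2)) z) := sA.hasSum.sub (sB.hasSum.mul_left L)
    have hf : HasSum (fun n => if n ∈ Finset.range N then |r n - L| else 0) C := by
      have := hasSum_sum_of_ne_finset_zero (L := SummationFilter.unconditional ℕ) (f := fun n => if n ∈ Finset.range N then |r n - L| else 0)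
        (s := Finset.range N) (fun b hb => if_neg hb)
      convert this using 1
      exact Finset.sum_congr rfl fun n hn => (if_pos hn).symm
    have hm := hf.add (sB.hasSum.mul_left (ε / 2))
    have := tsum_of_norm_bounded hm (f := fun n => uc 1 n * z ^ n - L * (v (1/2) n * z ^ n)) ?_
    · rw [hd.tsum_eq, Real.norm_eq_abs] at this
      exact this
    · intro n
      have e : uc 1 n * z ^ n - L * (v (1/2) n * z ^ n) = (r n - L) * (v (1/2) n * z ^ n) := by
        simp only [uc, u, r]; ring
      have hv := (v_pos (a := 1/2) (by norm_num) n).le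
      have hzn : 0 ≤ z ^ n := pow_nonneg hz0 n
      have hx : 0 ≤ v (1/2) n * z ^ n := mul_nonneg hv hzn
      have hx1 : v (1/2) n * z ^ n ≤ 1 :=
        mul_le_one₀ (v_le (by norm_num) (by norm_num) n) hzn (pow_le_one₀ hz0 hzI.2.le)
      rw [e, Real.norm_eq_abs, abs_mul, abs_of_nonneg hx]
      by_cases hn : n ∈ Finset.range N
      · rw [if_pos hn]
        have := mul_le_mul_of_nonneg_left hx1 (abs_nonneg (r n - L))
        have h2 : 0 ≤ ε / 2 * (v (1/2) n * z ^ n) := by positivity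
        linarith
      · rw [if_neg hn, zero_add]
        have := hN n (by simpa using hn)
        rw [Real.dist_eq] at this
        exact mul_le_mul_of_nonneg_right this.le hx
  have hB := B_sqrt hz0 hzI.2
  have hs0 := Real.sqrt_nonneg (1 - z)
  have e2 : A 1 z * √(1 - z) - L = (A 1 z - L * ps (v (1/2)) z) * √(1 - z) := by
    linear_combination L * hB
  rw [Real.dist_eq, e2, abs_mul, abs_of_nonneg hs0]
  have := mul_le_mul_of_nonneg_right bnd hs0
  have e3 : (C + ε / 2 * ps (v (1/2)) z) * √(1 - z) = C * √(1 - z) + ε / 2 := by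
    linear_combination (ε / 2) * hB
  linarith

lemma final_rel : 2 * A 0 (2/27) + 15 * A 1 (2/27) = 27 / (4 * π) := by
  have hI : Set.Ioo (0 : ℝ) (1/3) ∈ 𝓝[<] (1/3 : ℝ) := Ioo_mem_nhdsLT (by norm_num)
  have hz : Tendsto z1 (𝓝[<] (1/3)) (𝓝[<] 1) := by
    refine tendsto_nhdsWithin_iff.mpr ⟨?_, ?_⟩
    · have := (z1_deriv (s := 1/3) (by norm_num)).continuousAt.tendsto
      rw [show z1 (1/3) = 1 by norm_num [z1]] at this
      exact this.mono_left nhdsWithin_le_nhds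
    · filter_upwards [hI] with s hs using z1_lt hs.1.le hs.2
  have h1 := abel.comp hz
  have hc : Tendsto (fun s : ℝ => 3 * √(1 + s)) (𝓝[<] (1/3)) (𝓝 (3 * √(1 + 1/3))) := by
    have : ContinuousAt (fun s : ℝ => 3 * √(1 + s)) (1/3) := by fun_prop
    exact this.tendsto.mono_left nhdsWithin_le_nhds
  have h2 := h1.mul hc
  have c0 := cAz2 0 (s := 1/3) (by norm_num) le_rfl
  have c1 := cAz2 1 (s := 1/3) (by norm_num) le_rfl
  have h3 : ContinuousAt (fun s => s * (3 - s) * A 0 (z2 s) + (1 + s) * (6 - 3 * s) * A 1 (z2 s))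
      (1/3) := by fun_prop
  have h4 := h3.tendsto.mono_left (nhdsWithin_le_nhds (s := Set.Iio (1/3)))
  have h5 := tendsto_nhds_unique_of_eventuallyEq h2 h4 ?_
  · rw [show z2 (1/3) = 2/27 by norm_num [z2]] at h5
    have e : √(1 + 1/3 : ℝ) = 2 / √3 := by
      rw [show (1 + 1/3 : ℝ) = 2 ^ 2 / 3 by norm_num, Real.sqrt_div (by norm_num),
        Real.sqrt_sq (by norm_num)]
    have h3 : √(3 : ℝ) ≠ 0 := by positivity
    have hpi := Real.pi_ne_zero
    have e2 : √3 / (2 * π) * (3 * √(1 + 1/3 : ℝ)) = 3 / π := by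
      rw [e]; field_simp
    rw [e2] at h5
    have e3 : 27 / (4 * π) = 9/4 * (3 / π) := by field_simp; norm_num
    rw [e3, h5]; ring
  · filter_upwards [hI] with s hs
    rw [← main_rel hs.1.le hs.2]
    simp only [Function.comp]
    have hs1 : 0 < 1 + s := by linarith [hs.1]
    have hq : 0 < √(1 + s) := Real.sqrt_pos.mpr hs1
    have hqq : √(1 + s) ^ 2 = 1 + s := Real.sq_sqrt hs1.le
    have e : √(1 - z1 s) = (1 - 3 * s) / ((1 + s) * √(1 + s)) := by
      rw [Real.sqrt_eq_iff_mul_self_eq (by linarith [z1_lt hs.1.le hs.2])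
        (div_nonneg (by linarith [hs.2]) (by positivity)), one_sub_z1 hs.1.le]
      rw [div_mul_div_comm, show (1 + s) * √(1 + s) * ((1 + s) * √(1 + s))
        = (1 + s) ^ 2 * √(1 + s) ^ 2 by ring, hqq]
      ring
    rw [e]
    field_simp

end RamaProof

open RamaProof
theorem stmt_14 :
    ∑' n : ℕ, (poch (1/2) n * poch (1/3) n * poch (2/3) n) / (poch 1 n)^3 * (15*(n:ℝ)+2) * ((2:ℝ)/27)^n = 27 / (4*π) := by
  have hz : |(2/27 : ℝ)| < 1 := by rw [abs_of_pos] <;> norm_num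
  have s0 := (PB_uc 0).summable hz
  have s1 := (PB_uc 1).summable hz
  have hs := (s0.hasSum.mul_left 2).add (s1.hasSum.mul_left 15)
  rw [← final_rel]
  refine Eq.trans ?_ hs.tsum_eq
  congr 1
  ext n
  have := (poch_pos one_pos n).ne'
  simp only [uc, u, v]
  field_simp
  ring
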